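/- Let r = r(n) ≥ 3 and m = m(n) with r^{-2} n ≤ m = o(r^{-3} n^{3/2}) as n → ∞, let ξ = O(1) be a nonnegative integer, and let H ∈ H_r^+(n, m−ξ). Let N'_{2r−2} be the number of (2r−2)-element subsets of [n] that contain exactly one pair of vertices lying in a common edge of H. Then, uniformly over all such H and ξ, N'_{2r−2} = C(r,2) m C(n−2, 2r−4) · ( 1 + O( ( r^2 n log(r^{-2}n) + r^4 m ) / n^2 ) ). -/

import Mathlib

open Filter Finset

/-- `Hgraphs n r m`: the set of `r`-graphs on vertex set `Fin n` with exactly `m` edges. -/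
def Hgraphs (n r m : ℕ) : Finset (Finset (Finset (Fin n))) :=
  Finset.univ.filter fun H => (∀ e ∈ H, e.card = r) ∧ H.card = m

/-- A hypergraph is linear if any two distinct edges share at most one vertex. -/
def IsLinear {n : ℕ} (H : Finset (Finset (Fin n))) : Prop :=
  ∀ e ∈ H, ∀ f ∈ H, e ≠ f → (e ∩ f).card ≤ 1

instance {n : ℕ} : DecidablePred (IsLinear (n := n)) := fun _ => by
  unfold IsLinear; infer_instance

/-- `Lgraphs n r m`: the set of linear `r`-graphs on `Fin n` with exactly `m` edges. -/
def Lgraphs (n r m : ℕ) : Finset (Finset (Finset (Fin n))) :=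
  (Hgraphs n r m).filter IsLinear

/-- The degree of a vertex: the number of edges containing it. -/
def hdegree {n : ℕ} (H : Finset (Finset (Fin n))) (v : Fin n) : ℕ :=
  (H.filter fun e => v ∈ e).card

/-- `C` is a cluster of `H`: the edge set of a component, with at least two edges, of the
graph on the edges of `H` in which two edges are adjacent iff they are linked (they meet in
exactly two vertices). -/
def IsCluster {n : ℕ} (H C : Finset (Finset (Fin n))) : Prop :=
  C ⊆ H ∧ 2 ≤ C.card ∧
  (∀ e ∈ C, ∀ f ∈ C,
    Relation.ReflTransGen (fun a b => a ∈ C ∧ b ∈ C ∧ (a ∩ b).card = 2) e f) ∧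
  (∀ e ∈ C, ∀ f ∈ H, (e ∩ f).card = 2 → f ∈ C)

/-- Type-1 cluster: three edges spanning `3r-4` vertices, one edge `e` linked to each of
`f, g` through two disjoint `2`-subsets of `e`, with `f` and `g` meeting only inside `e`. -/
def IsType1 {n : ℕ} (r : ℕ) (C : Finset (Finset (Fin n))) : Prop :=
  ∃ e f g : Finset (Fin n), C = {e, f, g} ∧ e ≠ f ∧ e ≠ g ∧ f ≠ g ∧
    (C.sup id).card = 3 * r - 4 ∧
    (e ∩ f).card = 2 ∧ (e ∩ g).card = 2 ∧ Disjoint (e ∩ f) (e ∩ g) ∧ f ∩ g ⊆ e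

/-- Type-2 cluster: as Type-1 but the two `2`-subsets of `e` share exactly one vertex. -/
def IsType2 {n : ℕ} (r : ℕ) (C : Finset (Finset (Fin n))) : Prop :=
  ∃ e f g : Finset (Fin n), C = {e, f, g} ∧ e ≠ f ∧ e ≠ g ∧ f ≠ g ∧
    (C.sup id).card = 3 * r - 4 ∧
    (e ∩ f).card = 2 ∧ (e ∩ g).card = 2 ∧ ((e ∩ f) ∩ (e ∩ g)).card = 1 ∧ f ∩ g ⊆ e

/-- Type-3 cluster: three edges containing a common `2`-subset and pairwise disjoint
outside it. -/
def IsType3 {n : ℕ} (r : ℕ) (C : Finset (Finset (Fin n))) : Prop :=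
  ∃ e f g : Finset (Fin n), C = {e, f, g} ∧ e ≠ f ∧ e ≠ g ∧ f ≠ g ∧
    (C.sup id).card = 3 * r - 4 ∧
    ∃ s : Finset (Fin n), s.card = 2 ∧ e ∩ f = s ∧ e ∩ g = s ∧ f ∩ g = s

/-- Type-4 cluster: exactly two linked edges. -/
def IsType4 {n : ℕ} (C : Finset (Finset (Fin n))) : Prop :=
  ∃ e f : Finset (Fin n), C = {e, f} ∧ e ≠ f ∧ (e ∩ f).card = 2

/-- The number of clusters of `H` satisfying a property `P`. -/
noncomputable def clusterCount {n : ℕ} (H : Finset (Finset (Fin n)))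
    (P : Finset (Finset (Fin n)) → Prop) : ℕ :=
  {C | IsCluster H C ∧ P C}.ncard

noncomputable def M0star (n r m : ℕ) : ℕ :=
  ⌈Real.log ((n : ℝ) / (r : ℝ) ^ 2) + 81 * (r : ℝ) ^ 2 * (m : ℝ) / (n : ℝ)⌉₊

noncomputable def M0 (n r m : ℕ) : ℕ := M0star n r m + 3

noncomputable def M1 (n r m : ℕ) : ℕ :=
  ⌈Real.log ((n : ℝ) / (r : ℝ) ^ 2) + 81 * (r : ℝ) ^ 8 * (m : ℝ) ^ 3 / (2 * (n : ℝ) ^ 4)⌉₊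

noncomputable def M2 (n r m : ℕ) : ℕ :=
  ⌈Real.log ((n : ℝ) / (r : ℝ) ^ 2) + 81 * (r : ℝ) ^ 7 * (m : ℝ) ^ 3 / (2 * (n : ℝ) ^ 4)⌉₊

noncomputable def M3 (n r m : ℕ) : ℕ :=
  ⌈Real.log ((n : ℝ) / (r : ℝ) ^ 2) + 81 * (r : ℝ) ^ 6 * (m : ℝ) ^ 3 / (2 * (n : ℝ) ^ 4)⌉₊

noncomputable def M4 (n r m : ℕ) : ℕ :=
  ⌈Real.log ((n : ℝ) / (r : ℝ) ^ 2) + 81 * (r : ℝ) ^ 4 * (m : ℝ) ^ 2 / (2 * (n : ℝ) ^ 2)⌉₊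

/-- `H_r^+(n,m)` with a prescribed degree bound `d₀` in place of property (g). -/
def HplusAux (n r m d₀ : ℕ) : Set (Finset (Finset (Fin n))) :=
  {H | H ∈ Hgraphs n r m ∧
    (∀ e ∈ H, ∀ f ∈ H, e ≠ f → (e ∩ f).card ≤ 2) ∧
    (∀ C, IsCluster H C → IsType1 r C ∨ IsType2 r C ∨ IsType3 r C ∨ IsType4 C) ∧
    (∀ C D, IsCluster H C → IsCluster H D → C ≠ D →
      ((C.sup id) ∩ (D.sup id)).card ≤ 1) ∧
    (∀ C D E, IsCluster H C → IsCluster H D → IsCluster H E →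
      C ≠ D → C ≠ E → D ≠ E →
      (IsType1 r C ∨ IsType2 r C ∨ IsType3 r C) →
      (IsType1 r D ∨ IsType2 r D ∨ IsType3 r D) →
      (IsType1 r E ∨ IsType2 r E ∨ IsType3 r E) →
      9 * r - 13 ≤ ((C.sup id) ∪ (D.sup id) ∪ (E.sup id)).card) ∧
    (∀ C D E, IsCluster H C → IsCluster H D → IsCluster H E →
      C ≠ D → C ≠ E → D ≠ E → IsType4 C → IsType4 D → IsType4 E →
      6 * r - 8 ≤ ((C.sup id) ∪ (D.sup id) ∪ (E.sup id)).card) ∧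
    clusterCount H (IsType1 r) ≤ M1 n r m ∧
    clusterCount H (IsType2 r) ≤ M2 n r m ∧
    clusterCount H (IsType3 r) ≤ M3 n r m ∧
    clusterCount H IsType4 ≤ M4 n r m ∧
    (∀ v, hdegree H v ≤ d₀)}

/-- `H_r^+(n,m)`: `r`-graphs with `m` edges satisfying properties (a)–(g). -/
noncomputable def Hplus (n r m : ℕ) : Set (Finset (Finset (Fin n))) :=
  HplusAux n r m (M0 n r m)

/-- `H_r^{++}(n,m)`: as `H_r^+(n,m)` but with the stronger degree bound `M₀*`. -/
noncomputable def Hplusplus (n r m : ℕ) : Set (Finset (Finset (Fin n))) :=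
  HplusAux n r m (M0star n r m)

/-- `C^+_{h₁,h₂,h₃,h₄}`: members of `H_r^+(n,m)` with exactly `hᵢ` Type-`i` clusters. -/
noncomputable def Cplus (n r m h₁ h₂ h₃ h₄ : ℕ) : Set (Finset (Finset (Fin n))) :=
  {H ∈ Hplus n r m | clusterCount H (IsType1 r) = h₁ ∧ clusterCount H (IsType2 r) = h₂ ∧
    clusterCount H (IsType3 r) = h₃ ∧ clusterCount H IsType4 = h₄}

/-- `C^{++}_{h₁,h₂,h₃,h₄}`: members of `H_r^{++}(n,m)` with exactly `hᵢ` Type-`i` clusters. -/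
noncomputable def Cplusplus (n r m h₁ h₂ h₃ h₄ : ℕ) : Set (Finset (Finset (Fin n))) :=
  {H ∈ Hplusplus n r m | clusterCount H (IsType1 r) = h₁ ∧ clusterCount H (IsType2 r) = h₂ ∧
    clusterCount H (IsType3 r) = h₃ ∧ clusterCount H IsType4 = h₄}

/-- The pairs of vertices lying in a common edge of `H`. -/
def coveredPairs {α : Type*} [Fintype α] [DecidableEq α] (H : Finset (Finset α)) :
    Finset (Finset α) :=
  (univ.powersetCard 2).filter fun q => ∃ e ∈ H, q ⊆ e

section Counting

variable {α : Type*} [DecidableEq α]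

lemma sum_card_filter_comm {β γ : Type*} (s : Finset β) (t : Finset γ) (R : β → γ → Prop)
    [∀ b c, Decidable (R b c)] :
    ∑ b ∈ s, #{c ∈ t | R b c} = ∑ c ∈ t, #{b ∈ s | R b c} :=
  Finset.sum_card_bipartiteAbove_eq_sum_card_bipartiteBelow R

lemma card_filter_exactly_one_le (Q 𝒮 : Finset (Finset α)) :
    #{S ∈ 𝒮 | #{q ∈ Q | q ⊆ S} = 1} ≤ ∑ q ∈ Q, #{S ∈ 𝒮 | q ⊆ S} := by
  rw [sum_card_filter_comm _ _ (fun q S : Finset α => q ⊆ S),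
    Finset.card_filter]
  refine Finset.sum_le_sum fun S _ => ?_
  split_ifs with h <;> omega

lemma sum_card_superset_le (Q 𝒮 : Finset (Finset α)) :
    ∑ q ∈ Q, #{S ∈ 𝒮 | q ⊆ S} ≤ #{S ∈ 𝒮 | #{q ∈ Q | q ⊆ S} = 1} +
      ∑ q ∈ Q, ∑ q' ∈ Q.erase q, #{S ∈ 𝒮 | q ∪ q' ⊆ S} := by
  have key : ∑ q ∈ Q, ∑ q' ∈ Q.erase q, #{S ∈ 𝒮 | q ∪ q' ⊆ S} =
      ∑ S ∈ 𝒮, #({q ∈ Q | q ⊆ S}.offDiag) := by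
    have h1 : ∀ q ∈ Q, ∑ q' ∈ Q.erase q, #{S ∈ 𝒮 | q ∪ q' ⊆ S} =
        ∑ S ∈ 𝒮, #{q' ∈ Q.erase q | q ∪ q' ⊆ S} := fun q _ =>
      sum_card_filter_comm _ _ (fun q' S => q ∪ q' ⊆ S)
    rw [Finset.sum_congr rfl h1, Finset.sum_comm]
    refine Finset.sum_congr rfl fun S _ => ?_
    rw [← Finset.card_sigma]
    refine Finset.card_nbij' (fun p => (p.1, p.2)) (fun p => ⟨p.1, p.2⟩) ?_ ?_ ?_ ?_
    · rintro ⟨a, b⟩ h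
      simp only [coe_sigma, Set.mem_sigma_iff, mem_coe, mem_filter, mem_erase,
        union_subset_iff, mem_offDiag] at h ⊢
      tauto
    · rintro ⟨a, b⟩ h
      simp only [coe_sigma, Set.mem_sigma_iff, mem_coe, mem_filter, mem_erase,
        union_subset_iff, mem_offDiag] at h ⊢
      tauto
    · rintro ⟨a, b⟩ _; rfl
    · rintro ⟨a, b⟩ _; rfl
  rw [key, sum_card_filter_comm _ _ (fun q S : Finset α => q ⊆ S),
    Finset.card_filter, ← Finset.sum_add_distrib]
  refine Finset.sum_le_sum fun S _ => ?_
  rw [Finset.offDiag_card]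
  generalize #{q ∈ Q | q ⊆ S} = c
  split_ifs with h
  · omega
  · rcases Nat.lt_or_ge c 2 with h2 | h2
    · interval_cases c <;> simp_all
    · have : 2 * c ≤ c * c := Nat.mul_le_mul_right c h2
      omega

lemma card_filter_superset [Fintype α] (T : Finset α) (k : ℕ) (hk : #T ≤ k) :
    #{S ∈ (univ : Finset α).powersetCard k | T ⊆ S} =
      (Fintype.card α - #T).choose (k - #T) := by
  rw [← Finset.card_compl, ← Finset.card_powersetCard]
  refine Finset.card_nbij' (fun S => S \ T) (fun S => S ∪ T) ?_ ?_ ?_ ?_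
  · intro S hS
    simp only [mem_coe, mem_filter, mem_powersetCard] at hS ⊢
    refine ⟨fun x hx => by simp_all, ?_⟩
    rw [Finset.card_sdiff_of_subset hS.2, hS.1.2]
  · intro S hS
    simp only [mem_coe, mem_filter, mem_powersetCard] at hS ⊢
    have hd : Disjoint S T := Finset.disjoint_left.2 fun x hx hT => by
      have := hS.1 hx; simp_all
    refine ⟨⟨subset_univ _, ?_⟩, subset_union_right⟩
    rw [Finset.card_union_of_disjoint hd]
    omega
  · intro S hS
    simp only [mem_coe, mem_filter] at hS
    exact Finset.sdiff_union_of_subset hS.2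
  · intro S hS
    simp only [mem_coe, mem_powersetCard] at hS
    have hd : Disjoint S T := Finset.disjoint_left.2 fun x hx hT => by
      have := hS.1 hx; simp_all
    exact Finset.union_sdiff_cancel_right hd

lemma sum_card_edges_containing_pair [Fintype α] (H : Finset (Finset α)) (r : ℕ)
    (hr : ∀ e ∈ H, #e = r) :
    ∑ q ∈ coveredPairs H, #{e ∈ H | q ⊆ e} = r.choose 2 * #H := by
  rw [sum_card_filter_comm _ _ (fun q e : Finset α => q ⊆ e),
    Finset.sum_congr rfl (g := fun _ => r.choose 2), Finset.sum_const, smul_eq_mul, mul_comm]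
  intro e he
  rw [← hr e he, ← Finset.card_powersetCard]
  congr 1
  ext q
  simp only [coveredPairs, mem_filter, mem_powersetCard]
  exact ⟨fun h => ⟨h.2, h.1.1.2⟩, fun h => ⟨⟨⟨subset_univ _, h.2⟩, e, he, h.1⟩, h.1⟩⟩

lemma card_coveredPairs_le [Fintype α] (H : Finset (Finset α)) (r : ℕ)
    (hr : ∀ e ∈ H, #e = r) : #(coveredPairs H) ≤ r.choose 2 * #H := by
  rw [← sum_card_edges_containing_pair H r hr, Finset.card_eq_sum_ones]
  refine Finset.sum_le_sum fun q hq => Finset.card_pos.2 ?_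
  obtain ⟨e, he, hqe⟩ := (mem_filter.1 hq).2
  exact ⟨e, mem_filter.2 ⟨he, hqe⟩⟩

lemma le_card_coveredPairs_add [Fintype α] (H : Finset (Finset α)) (r : ℕ)
    (hr : ∀ e ∈ H, #e = r) (h2 : ∀ e ∈ H, ∀ f ∈ H, e ≠ f → #(e ∩ f) ≤ 2) :
    r.choose 2 * #H ≤ #(coveredPairs H) + #{p ∈ H.offDiag | #(p.1 ∩ p.2) = 2} := by
  have h3 : ∑ q ∈ coveredPairs H, #{p ∈ H.offDiag | q ⊆ p.1 ∩ p.2} ≤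
      #{p ∈ H.offDiag | #(p.1 ∩ p.2) = 2} := by
    rw [sum_card_filter_comm _ _
      (fun q (p : Finset α × Finset α) => q ⊆ p.1 ∩ p.2), Finset.card_filter]
    refine Finset.sum_le_sum fun p hp => ?_
    rw [mem_offDiag] at hp
    have hle := h2 _ hp.1 _ hp.2.1 hp.2.2
    have hsub : {q ∈ coveredPairs H | q ⊆ p.1 ∩ p.2} ⊆
          (p.1 ∩ p.2).powersetCard 2 := by
      intro q hq
      simp only [coveredPairs, mem_filter, mem_powersetCard] at hq ⊢
      exact ⟨hq.2, hq.1.1.2⟩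
    have := Finset.card_le_card hsub
    rw [Finset.card_powersetCard] at this
    refine this.trans ?_
    interval_cases #(p.1 ∩ p.2) <;> simp
  rw [← sum_card_edges_containing_pair H r hr]
  refine le_trans ?_ (Nat.add_le_add_left h3 _)
  rw [Finset.card_eq_sum_ones, ← Finset.sum_add_distrib]
  refine Finset.sum_le_sum fun q _ => ?_
  have : {p ∈ H.offDiag | q ⊆ p.1 ∩ p.2} = {e ∈ H | q ⊆ e}.offDiag := by
    ext p
    simp only [mem_filter, mem_offDiag, subset_inter_iff]
    tauto
  rw [this, Finset.offDiag_card]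
  generalize #{e ∈ H | q ⊆ e} = c
  rcases Nat.lt_or_ge c 2 with h2 | h2
  · omega
  · have : 2 * c ≤ c * c := Nat.mul_le_mul_right c h2
    omega

lemma card_coveredPairs_mem_le [Fintype α] (H : Finset (Finset α)) (r d : ℕ)
    (hr : ∀ e ∈ H, #e = r) (x : α) (hd : #{e ∈ H | x ∈ e} ≤ d) :
    #{q ∈ coveredPairs H | x ∈ q} ≤ d * r := by
  have hsub : {q ∈ coveredPairs H | x ∈ q} ⊆
      {e ∈ H | x ∈ e}.biUnion fun e => e.image fun y => {x, y} := by
    intro q hq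
    simp only [coveredPairs, mem_filter, mem_powersetCard] at hq
    obtain ⟨⟨⟨-, h2⟩, e, he, hqe⟩, hx⟩ := hq
    obtain ⟨a, b, hab, rfl⟩ := Finset.card_eq_two.1 h2
    simp only [mem_biUnion, mem_filter, mem_image]
    refine ⟨e, ⟨he, hqe hx⟩, ?_⟩
    simp only [mem_insert, mem_singleton] at hx
    rcases hx with rfl | rfl
    · exact ⟨b, hqe (by simp), rfl⟩
    · exact ⟨a, hqe (by simp), Finset.pair_comm _ _⟩
  refine (Finset.card_le_card hsub).trans
    ((Finset.card_biUnion_le_card_mul _ _ r fun e he => ?_).trans (Nat.mul_le_mul_right r hd))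
  rw [mem_filter] at he
  exact Finset.card_image_le.trans (hr e he.1).le

lemma sum_card_superset_union_le [Fintype α] (H : Finset (Finset α)) (r d k : ℕ)
    (hr : ∀ e ∈ H, #e = r) (hd : ∀ x, #{e ∈ H | x ∈ e} ≤ d) (hk : 4 ≤ k)
    {q : Finset α} (hq : q ∈ coveredPairs H) :
    ∑ q' ∈ (coveredPairs H).erase q, #{S ∈ (univ : Finset α).powersetCard k | q ∪ q' ⊆ S} ≤
      2 * (d * r) * (Fintype.card α - 3).choose (k - 3) +
        #(coveredPairs H) * (Fintype.card α - 4).choose (k - 4) := by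
  have card_two : ∀ p ∈ coveredPairs H, #p = 2 := fun p hp =>
    (mem_powersetCard.1 (mem_filter.1 hp).1).2
  have hq2 := card_two q hq
  rw [← Finset.sum_filter_add_sum_filter_not _ (fun q' => Disjoint q q'), add_comm]
  refine Nat.add_le_add ?_ ?_
  · have hcard : #{q' ∈ (coveredPairs H).erase q | ¬ Disjoint q q'} ≤ 2 * (d * r) := by
      have hsub : {q' ∈ (coveredPairs H).erase q | ¬ Disjoint q q'} ⊆
          q.biUnion fun x => {q' ∈ coveredPairs H | x ∈ q'} := by
        intro q' hq'
        simp only [mem_filter, mem_erase, Finset.not_disjoint_iff] at hq'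
        obtain ⟨⟨-, h⟩, x, hx, hx'⟩ := hq'
        exact mem_biUnion.2 ⟨x, hx, mem_filter.2 ⟨h, hx'⟩⟩
      refine (Finset.card_le_card hsub).trans ?_
      rw [← hq2]
      exact Finset.card_biUnion_le_card_mul _ _ _ fun x _ =>
        card_coveredPairs_mem_le H r d hr x (hd x)
    refine (Finset.sum_le_card_nsmul _ _ ((Fintype.card α - 3).choose (k - 3)) ?_).trans
      (by rw [smul_eq_mul]; exact Nat.mul_le_mul_right _ hcard)
    intro q' hq'
    simp only [mem_filter, mem_erase] at hq'
    obtain ⟨⟨hne, hq'⟩, hdis⟩ := hq'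
    have hq'2 := card_two q' hq'
    have hsum := Finset.card_union_add_card_inter q q'
    have hpos : 0 < #(q ∩ q') :=
      Finset.card_pos.2 (Finset.not_disjoint_iff_nonempty_inter.1 hdis)
    have hlt : #(q ∩ q') < 2 := by
      by_contra! hge
      have h1 := Finset.eq_of_subset_of_card_le (inter_subset_left : q ∩ q' ⊆ q) (by omega)
      have h2 := Finset.eq_of_subset_of_card_le (inter_subset_right : q ∩ q' ⊆ q') (by omega)
      exact hne (h2.symm.trans h1)
    have h3 : #(q ∪ q') = 3 := by omega
    rw [card_filter_superset _ _ (by omega), h3]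
  · refine (Finset.sum_le_card_nsmul _ _ ((Fintype.card α - 4).choose (k - 4)) ?_).trans
      (by
        rw [smul_eq_mul]
        exact Nat.mul_le_mul_right _ (Finset.card_le_card
          ((filter_subset _ _).trans (erase_subset _ _))))
    intro q' hq'
    simp only [mem_filter, mem_erase] at hq'
    have h4 : #(q ∪ q') = 4 := by
      rw [Finset.card_union_of_disjoint hq'.2, hq2, card_two q' hq'.1.2]
    rw [card_filter_superset _ _ (by omega), h4]

end Counting

section Clusters

variable {n : ℕ} {H : Finset (Finset (Fin n))}

open Classical in
lemma exists_isCluster_of_linked {e f : Finset (Fin n)} (he : e ∈ H) (hf : f ∈ H)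
    (hne : e ≠ f) (hef : #(e ∩ f) = 2) : ∃ C, IsCluster H C ∧ e ∈ C ∧ f ∈ C := by
  set R : Finset (Fin n) → Finset (Fin n) → Prop :=
    fun a b => a ∈ H ∧ b ∈ H ∧ #(a ∩ b) = 2 with hR
  set C := H.filter fun g => Relation.ReflTransGen R e g with hC
  have heC : e ∈ C := mem_filter.2 ⟨he, .refl⟩
  have hfC : f ∈ C := mem_filter.2 ⟨hf, .single ⟨he, hf, hef⟩⟩
  have hpath : ∀ g, Relation.ReflTransGen R e g →
      Relation.ReflTransGen (fun a b => a ∈ C ∧ b ∈ C ∧ #(a ∩ b) = 2) e g := by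
    intro g hg
    induction hg with
    | refl => exact .refl
    | tail hab hbc ih =>
      exact ih.tail ⟨mem_filter.2 ⟨hbc.1, hab⟩, mem_filter.2 ⟨hbc.2.1, hab.tail hbc⟩, hbc.2.2⟩
  have hsymm : Std.Symm (fun a b : Finset (Fin n) => a ∈ C ∧ b ∈ C ∧ #(a ∩ b) = 2) :=
    ⟨fun a b h => ⟨h.2.1, h.1, by rw [inter_comm]; exact h.2.2⟩⟩
  refine ⟨C, ⟨filter_subset _ _, ?_, ?_, ?_⟩, heC, hfC⟩
  · exact Finset.one_lt_card.2 ⟨e, heC, f, hfC, hne⟩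
  · intro a ha b hb
    exact ((Relation.ReflTransGen.stdSymm).symm _ _ (hpath a (mem_filter.1 ha).2)).trans
      (hpath b (mem_filter.1 hb).2)
  · intro a ha b hb hab
    have ha := mem_filter.1 ha
    exact mem_filter.2 ⟨hb, ha.2.tail ⟨ha.1, hb, hab⟩⟩

open Classical in
lemma card_linked_pairs_le (r : ℕ)
    (htype : ∀ C, IsCluster H C → IsType1 r C ∨ IsType2 r C ∨ IsType3 r C ∨ IsType4 C) :
    #{p ∈ H.offDiag | #(p.1 ∩ p.2) = 2} ≤
      9 * (clusterCount H (IsType1 r) + clusterCount H (IsType2 r) +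
        clusterCount H (IsType3 r) + clusterCount H IsType4) := by
  have hsub : {p ∈ H.offDiag | #(p.1 ∩ p.2) = 2} ⊆
      (univ.filter (IsCluster H)).biUnion fun C => C ×ˢ C := by
    rintro ⟨e, f⟩ h
    simp only [mem_filter, mem_offDiag] at h
    obtain ⟨C, hC, heC, hfC⟩ := exists_isCluster_of_linked h.1.1 h.1.2.1 h.1.2.2 h.2
    exact mem_biUnion.2 ⟨C, by simpa using hC, mem_product.2 ⟨heC, hfC⟩⟩
  have hcard : ∀ C ∈ univ.filter (IsCluster H), #(C ×ˢ C) ≤ 9 := by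
    intro C hC
    have h3 : #C ≤ 3 := by
      rcases htype C (mem_filter.1 hC).2 with
        ⟨e, f, g, rfl, -⟩ | ⟨e, f, g, rfl, -⟩ | ⟨e, f, g, rfl, -⟩ | ⟨e, f, rfl, -⟩
      · exact card_le_three
      · exact card_le_three
      · exact card_le_three
      · exact card_le_two.trans (by norm_num)
    rw [card_product]
    exact Nat.mul_le_mul h3 h3
  have hcount : #(univ.filter (IsCluster H)) ≤
      clusterCount H (IsType1 r) + clusterCount H (IsType2 r) +
        clusterCount H (IsType3 r) + clusterCount H IsType4 := by
    rw [← Set.ncard_coe_finset]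
    have hcover : ((univ.filter (IsCluster H) : Finset _) : Set (Finset (Finset (Fin n)))) ⊆
        (({C | IsCluster H C ∧ IsType1 r C} ∪ {C | IsCluster H C ∧ IsType2 r C}) ∪
          {C | IsCluster H C ∧ IsType3 r C}) ∪ {C | IsCluster H C ∧ IsType4 C} := by
      intro C hC
      have hC : IsCluster H C := by simpa using hC
      have := htype C hC
      simp only [Set.mem_union, Set.mem_ofPred_eq]
      tauto
    refine (Set.ncard_le_ncard hcover (Set.toFinite _)).trans ?_
    refine (Set.ncard_union_le _ _).trans (Nat.add_le_add_right ?_ _)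
    refine (Set.ncard_union_le _ _).trans (Nat.add_le_add_right ?_ _)
    exact Set.ncard_union_le _ _
  refine (Finset.card_le_card hsub).trans ((Finset.card_biUnion_le_card_mul _ _ 9 hcard).trans ?_)
  rw [mul_comm]
  exact Nat.mul_le_mul_left 9 hcount

end Clusters

section Estimates

lemma exactly_one_covered_pair_bounds {α : Type*} [Fintype α] [DecidableEq α]
    (H : Finset (Finset α)) (r d k : ℕ) (hr : ∀ e ∈ H, #e = r)
    (hd : ∀ x, #{e ∈ H | x ∈ e} ≤ d) (hk : 4 ≤ k) :
    #{S ∈ (univ : Finset α).powersetCard k | #{q ∈ coveredPairs H | q ⊆ S} = 1} ≤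
        #(coveredPairs H) * (Fintype.card α - 2).choose (k - 2) ∧
      #(coveredPairs H) * (Fintype.card α - 2).choose (k - 2) ≤
        #{S ∈ (univ : Finset α).powersetCard k | #{q ∈ coveredPairs H | q ⊆ S} = 1} +
          #(coveredPairs H) * (2 * (d * r) * (Fintype.card α - 3).choose (k - 3) +
            #(coveredPairs H) * (Fintype.card α - 4).choose (k - 4)) := by
  have htotal : ∑ q ∈ coveredPairs H, #{S ∈ (univ : Finset α).powersetCard k | q ⊆ S} =
      #(coveredPairs H) * (Fintype.card α - 2).choose (k - 2) := by
    rw [← smul_eq_mul, ← Finset.sum_const]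
    refine Finset.sum_congr rfl fun q hq => ?_
    have hq2 : #q = 2 := (mem_powersetCard.1 (mem_filter.1 hq).1).2
    rw [card_filter_superset q k (by omega), hq2]
  rw [← htotal]
  refine ⟨card_filter_exactly_one_le _ _, (sum_card_superset_le _ _).trans ?_⟩
  refine Nat.add_le_add_left ?_ _
  rw [← smul_eq_mul (#(coveredPairs H))]
  exact Finset.sum_le_card_nsmul _ _ _ fun q hq => sum_card_superset_union_le H r d k hr hd hk hq

lemma filter_exactly_one_eq {n : ℕ} (H : Finset (Finset (Fin n))) (k : ℕ) :
    (Finset.univ.powerset.filter fun S : Finset (Fin n) =>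
      S.card = k ∧ ((S.powersetCard 2).filter fun q => ∃ e ∈ H, q ⊆ e).card = 1) =
      {S ∈ (univ : Finset (Fin n)).powersetCard k | #{q ∈ coveredPairs H | q ⊆ S} = 1} := by
  ext S
  have : (S.powersetCard 2).filter (fun q => ∃ e ∈ H, q ⊆ e) =
      {q ∈ coveredPairs H | q ⊆ S} := by
    ext q
    simp only [coveredPairs, mem_filter, mem_powersetCard, subset_univ, true_and]
    tauto
  simp only [this, mem_filter, mem_powersetCard, mem_powerset]
  tauto

lemma choose_sub_one_le {a b : ℕ} {x y : ℝ} (ha : x ≤ 2 * ((a : ℝ) + 1)) (hx : 0 < x)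
    (hb : (b : ℝ) + 1 ≤ y) :
    (a.choose b : ℝ) ≤ 2 * y / x * ((a + 1).choose (b + 1) : ℝ) := by
  have h : ((a : ℝ) + 1) * a.choose b = (a + 1).choose (b + 1) * ((b : ℝ) + 1) := by
    exact_mod_cast Nat.add_one_mul_choose_eq a b
  have hA : (0 : ℝ) ≤ a.choose b := by positivity
  have hB : (0 : ℝ) ≤ (a + 1).choose (b + 1) := by positivity
  rw [div_mul_eq_mul_div, le_div_iff₀ hx]
  nlinarith [mul_le_mul_of_nonneg_right ha hA, mul_le_mul_of_nonneg_left hb hB]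

lemma natCeil_add_le {x y : ℝ} (hx : 1 ≤ x) (hy : 0 ≤ y) : (⌈x + y⌉₊ : ℝ) ≤ 2 * x + y := by
  linarith [Nat.ceil_lt_add_one (show 0 ≤ x + y by linarith)]

lemma cast_M0_le {n r m m' : ℕ} (hL : 1 ≤ Real.log ((n : ℝ) / (r : ℝ) ^ 2)) (hm : m' ≤ m) :
    (M0 n r m' : ℝ) ≤
      5 * Real.log ((n : ℝ) / (r : ℝ) ^ 2) + 81 * (r : ℝ) ^ 2 * m / n := by
  have hm' : (m' : ℝ) ≤ m := by exact_mod_cast hm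
  have h1 : (M0star n r m' : ℝ) ≤ _ :=
    natCeil_add_le hL (show 0 ≤ 81 * (r : ℝ) ^ 2 * (m' : ℝ) / (n : ℝ) by positivity)
  have h2 : 81 * (r : ℝ) ^ 2 * (m' : ℝ) / (n : ℝ) ≤ 81 * (r : ℝ) ^ 2 * m / n := by gcongr
  rw [M0]
  push_cast
  linarith

/-- The sum of the bounds on the numbers of clusters of the four types. -/
lemma cast_sum_M_le {n r m m' : ℕ} (hr : 3 ≤ r) (hn : 0 < n)
    (hL : 1 ≤ Real.log ((n : ℝ) / (r : ℝ) ^ 2)) (hm : m' ≤ m)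
    (ht : (r : ℝ) ^ 4 * m / (n : ℝ) ^ 2 ≤ 1) :
    ((M1 n r m' + M2 n r m' + M3 n r m' + M4 n r m' : ℕ) : ℝ) ≤
      8 * Real.log ((n : ℝ) / (r : ℝ) ^ 2) + 164 * ((r : ℝ) ^ 4 * m / (n : ℝ) ^ 2) * m := by
  have hm' : (m' : ℝ) ≤ m := by exact_mod_cast hm
  have hr1 : (1 : ℝ) ≤ r := by exact_mod_cast (show 1 ≤ r by omega)
  have hn' : (0 : ℝ) < n := by exact_mod_cast hn
  set t := (r : ℝ) ^ 4 * m / (n : ℝ) ^ 2 with htdef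
  have ht0 : 0 ≤ t := by positivity
  have h8 : ∀ j ≤ 8, 81 * (r : ℝ) ^ j * (m' : ℝ) ^ 3 / (2 * (n : ℝ) ^ 4) ≤ 41 * t * m := by
    intro j hj
    calc 81 * (r : ℝ) ^ j * (m' : ℝ) ^ 3 / (2 * (n : ℝ) ^ 4)
        ≤ 81 * (r : ℝ) ^ 8 * (m : ℝ) ^ 3 / (2 * (n : ℝ) ^ 4) := by gcongr
      _ = 81 / 2 * (t * m) * t := by rw [htdef]; field_simp
      _ ≤ 81 / 2 * (t * m) * 1 := by gcongr
      _ ≤ 41 * t * m := by nlinarith [show 0 ≤ t * (m : ℝ) by positivity]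
  have h4 : 81 * (r : ℝ) ^ 4 * (m' : ℝ) ^ 2 / (2 * (n : ℝ) ^ 2) ≤ 41 * t * m := by
    calc 81 * (r : ℝ) ^ 4 * (m' : ℝ) ^ 2 / (2 * (n : ℝ) ^ 2)
        ≤ 81 * (r : ℝ) ^ 4 * (m : ℝ) ^ 2 / (2 * (n : ℝ) ^ 2) := by gcongr
      _ = 81 / 2 * (t * m) := by rw [htdef]; field_simp
      _ ≤ 41 * t * m := by nlinarith [show 0 ≤ t * (m : ℝ) by positivity]
  have b1 : (M1 n r m' : ℝ) ≤ _ := natCeil_add_le hL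
    (show 0 ≤ 81 * (r : ℝ) ^ 8 * (m' : ℝ) ^ 3 / (2 * (n : ℝ) ^ 4) by positivity)
  have b2 : (M2 n r m' : ℝ) ≤ _ := natCeil_add_le hL
    (show 0 ≤ 81 * (r : ℝ) ^ 7 * (m' : ℝ) ^ 3 / (2 * (n : ℝ) ^ 4) by positivity)
  have b3 : (M3 n r m' : ℝ) ≤ _ := natCeil_add_le hL
    (show 0 ≤ 81 * (r : ℝ) ^ 6 * (m' : ℝ) ^ 3 / (2 * (n : ℝ) ^ 4) by positivity)
  have b4 : (M4 n r m' : ℝ) ≤ _ := natCeil_add_le hL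
    (show 0 ≤ 81 * (r : ℝ) ^ 4 * (m' : ℝ) ^ 2 / (2 * (n : ℝ) ^ 2) by positivity)
  push_cast
  linarith [h8 8 le_rfl, h8 7 (by norm_num), h8 6 (by norm_num)]

lemma sq_div_three_le_choose_two {r : ℕ} (hr : 3 ≤ r) :
    (r : ℝ) ^ 2 / 3 ≤ (r.choose 2 : ℝ) ∧ (r.choose 2 : ℝ) ≤ (r : ℝ) ^ 2 / 2 := by
  have hr' : (3 : ℝ) ≤ r := by exact_mod_cast hr
  rw [Nat.cast_choose_two]
  constructor <;> nlinarith

/-- The elementary inequality combining the double counting with the bounds on its terms: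
`N` is the number to be estimated, `P` the number of covered pairs, `d` the degree bound, `M` the
bound on the number of clusters, and `c`, `A`, `A₃`, `A₄` are the binomial coefficients. -/
lemma abs_sub_le_of_counting_bounds {r n m m' B L d M P c A A₃ A₄ N : ℝ} (hr' : 3 ≤ r)
    (hn0 : 0 < n) (hm0 : 0 ≤ m) (hB0 : 0 ≤ B) (hd0 : 0 ≤ d) (hP0 : 0 ≤ P) (hA0 : 0 ≤ A)
    (hA30 : 0 ≤ A₃) (hA40 : 0 ≤ A₄) (hL : 1 ≤ L) (hlb : n / r ^ 2 ≤ m)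
    (hc1 : r ^ 2 / 3 ≤ c) (hc2 : c ≤ r ^ 2 / 2) (hmm : m - B ≤ m') (hmm' : m' ≤ m)
    (hd : d ≤ 5 * L + 81 * r ^ 2 * m / n)
    (hM : M ≤ 8 * L + 164 * (r ^ 4 * m / n ^ 2) * m)
    (hP1 : P ≤ c * m') (hP2 : c * m' ≤ P + 9 * M)
    (hA3 : A₃ ≤ 2 * (2 * r) / n * A) (hA4 : A₄ ≤ 2 * (2 * r) / n * A₃)
    (hup : N ≤ P * A) (hlow : P * A ≤ N + P * (2 * (d * r) * A₃ + P * A₄)) :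
    |N - c * m * A| ≤
      (6000 + B) * ((r ^ 2 * n * L + r ^ 4 * m) / n ^ 2) * (c * m * A) := by
  have hc0 : 0 ≤ c := (by positivity : 0 ≤ r ^ 2 / 3).trans hc1
  set t := r ^ 4 * m / n ^ 2 with ht_def
  set s := r ^ 2 * L / n with hs_def
  have hE : (r ^ 2 * n * L + r ^ 4 * m) / n ^ 2 = s + t := by
    rw [ht_def, hs_def]; field_simp
  rw [hE]
  have hr0 : 0 < r := by linarith
  have ht0 : 0 ≤ t := by positivity
  have hs0 : 0 ≤ s := by positivity
  have hnm : n ≤ r ^ 2 * m := by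
    rw [div_le_iff₀ (by positivity)] at hlb
    linarith
  have hLs : L ≤ r ^ 2 * m * s := by
    have h1 : L * 1 ≤ L * r ^ 2 := by
      gcongr; nlinarith
    calc L ≤ L * r ^ 2 := by linarith
      _ = n * s := by rw [hs_def]; field_simp
      _ ≤ r ^ 2 * m * s := by gcongr
  have h1s : 1 ≤ m * s := by
    have : n ≤ r ^ 2 * m * L := hnm.trans (le_mul_of_one_le_right (by positivity) hL)
    rw [hs_def, mul_div_assoc', le_div_iff₀ hn0]
    linarith
  have hMbound : 9 * M ≤ 4500 * (s + t) * (c * m) := by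
    have h1 : t * m ≤ r ^ 2 * m * t := by
      have : 1 * (t * m) ≤ r ^ 2 * (t * m) := by gcongr; nlinarith
      linarith
    have h2 : r ^ 2 * m * (s + t) ≤ 3 * c * m * (s + t) := by
      gcongr; linarith
    have h3 : 0 ≤ r ^ 2 * m * s := by positivity
    have h4 : 0 ≤ c * m * (s + t) := by positivity
    linarith
  have hxi : c * B ≤ B * (s + t) * (c * m) := by
    have h1 : c * B * 1 ≤ c * B * (m * s) := by gcongr
    have h2 : 0 ≤ c * B * (m * t) := by positivity
    linarith
  have hPc : P ≤ c * m := hP1.trans (by gcongr)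
  have hA3' : 2 * (d * r) * A₃ ≤ 648 * (s + t) * A := by
    calc 2 * (d * r) * A₃
        ≤ 2 * ((5 * L + 81 * r ^ 2 * m / n) * r) * (2 * (2 * r) / n * A) := by gcongr
      _ = (40 * s + 648 * t) * A := by rw [hs_def, ht_def]; field_simp; ring
      _ ≤ 648 * (s + t) * A := by gcongr; linarith
  have hA4' : P * A₄ ≤ 8 * (s + t) * A := by
    calc P * A₄ ≤ (r ^ 2 / 2 * m) * (2 * (2 * r) / n * (2 * (2 * r) / n * A)) := by
          gcongr
          · exact hPc.trans (by gcongr)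
          · exact hA4.trans (by gcongr)
      _ = 8 * t * A := by rw [ht_def]; field_simp; ring
      _ ≤ 8 * (s + t) * A := by gcongr; linarith
  have hbad : P * (2 * (d * r) * A₃ + P * A₄) ≤ (c * m) * (656 * (s + t) * A) := by
    gcongr
    linarith
  have hPlow : c * m - (4500 + B) * (s + t) * (c * m) ≤ P := by
    have : c * (m - B) ≤ c * m' := by gcongr
    linarith
  have hPA := mul_le_mul_of_nonneg_right hPlow hA0
  have hPA' := mul_le_mul_of_nonneg_right hPc hA0
  have hpos : 0 ≤ (s + t) * (c * m * A) := by positivity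
  have hposB : 0 ≤ B * ((s + t) * (c * m * A)) := by positivity
  rw [abs_le]
  constructor <;> linarith

/-- The non-asymptotic estimate behind the main theorem. -/
lemma abs_card_exactly_one_sub_le {n r m ξ B : ℕ} (hr : 3 ≤ r)
    (hlb : (n : ℝ) / (r : ℝ) ^ 2 ≤ m) (hrn : 4 * (r : ℝ) ^ 2 ≤ n)
    (hL : 1 ≤ Real.log ((n : ℝ) / (r : ℝ) ^ 2))
    (ht : (r : ℝ) ^ 4 * m / (n : ℝ) ^ 2 ≤ 1) (hξ : ξ ≤ B)
    {H : Finset (Finset (Fin n))} (hH : H ∈ Hplus n r (m - ξ)) :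
    |(#{S ∈ (univ : Finset (Fin n)).powersetCard (2 * r - 2) |
          #{q ∈ coveredPairs H | q ⊆ S} = 1} : ℝ)
        - (r.choose 2 : ℝ) * m * ((n - 2).choose (2 * r - 4) : ℝ)|
      ≤ (6000 + B) * (((r : ℝ) ^ 2 * n * Real.log ((n : ℝ) / (r : ℝ) ^ 2)
            + (r : ℝ) ^ 4 * m) / (n : ℝ) ^ 2)
        * ((r.choose 2 : ℝ) * m * ((n - 2).choose (2 * r - 4) : ℝ)) := by
  obtain ⟨hHg, h2, htype, -, -, -, hM1, hM2, hM3, hM4, hdeg⟩ := hH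
  obtain ⟨hcard, hsize⟩ := (mem_filter.1 hHg).2
  have hr' : (3 : ℝ) ≤ r := by exact_mod_cast hr
  have hn36 : (36 : ℝ) ≤ n := by nlinarith
  have hn : 36 ≤ n := by exact_mod_cast hn36
  have hn0 : (0 : ℝ) < n := by linarith
  obtain ⟨hup, hlow⟩ := exactly_one_covered_pair_bounds H r (M0 n r (m - ξ)) (2 * r - 2) hcard
    hdeg (by omega)
  have hP1 := card_coveredPairs_le H r hcard
  have hP2 := (le_card_coveredPairs_add H r hcard h2).trans
    (Nat.add_le_add_left ((card_linked_pairs_le r htype).trans (Nat.mul_le_mul_left 9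
      (Nat.add_le_add (Nat.add_le_add (Nat.add_le_add hM1 hM2) hM3) hM4))) _)
  rw [hsize] at hP1 hP2
  rw [Fintype.card_fin] at hup hlow
  rw [show 2 * r - 2 - 2 = 2 * r - 4 by omega] at hup hlow
  rw [show 2 * r - 2 - 3 = 2 * r - 5 by omega, show 2 * r - 2 - 4 = 2 * r - 6 by omega] at hlow
  have hd := cast_M0_le (m := m) (m' := m - ξ) hL (Nat.sub_le _ _)
  have hM := cast_sum_M_le (m' := m - ξ) hr (by omega) hL (Nat.sub_le _ _) ht
  have hA3 : ((n - 3).choose (2 * r - 5) : ℝ) ≤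
      2 * (2 * r) / n * ((n - 2).choose (2 * r - 4) : ℝ) := by
    have := choose_sub_one_le (a := n - 3) (b := 2 * r - 5) (x := n) (y := 2 * r)
      (by rw [Nat.cast_sub (by omega)]; push_cast; linarith) hn0
      (by rw [Nat.cast_sub (by omega)]; push_cast; linarith)
    rwa [show n - 3 + 1 = n - 2 by omega, show 2 * r - 5 + 1 = 2 * r - 4 by omega] at this
  have hA4 : ((n - 4).choose (2 * r - 6) : ℝ) ≤
      2 * (2 * r) / n * ((n - 3).choose (2 * r - 5) : ℝ) := by
    have := choose_sub_one_le (a := n - 4) (b := 2 * r - 6) (x := n) (y := 2 * r)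
      (by rw [Nat.cast_sub (by omega)]; push_cast; linarith) hn0
      (by rw [Nat.cast_sub (by omega)]; push_cast; linarith)
    rwa [show n - 4 + 1 = n - 3 by omega, show 2 * r - 6 + 1 = 2 * r - 5 by omega] at this
  obtain ⟨hc1, hc2⟩ := sq_div_three_le_choose_two hr
  have hmm : (m : ℝ) - B ≤ ((m - ξ : ℕ) : ℝ) := by
    have : m ≤ (m - ξ) + B := by omega
    have : (m : ℝ) ≤ ((m - ξ : ℕ) : ℝ) + B := by exact_mod_cast this
    linarith
  have hmm' : ((m - ξ : ℕ) : ℝ) ≤ m := by exact_mod_cast Nat.sub_le _ _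
  have hP1 : (#(coveredPairs H) : ℝ) ≤ r.choose 2 * ((m - ξ : ℕ) : ℝ) := by exact_mod_cast hP1
  have hP2 : (r.choose 2 : ℝ) * ((m - ξ : ℕ) : ℝ) ≤ #(coveredPairs H) +
      9 * ((M1 n r (m - ξ) + M2 n r (m - ξ) + M3 n r (m - ξ) + M4 n r (m - ξ) : ℕ) : ℝ) := by
    exact_mod_cast hP2
  have hup := (Nat.cast_le (α := ℝ)).2 hup
  have hlow := (Nat.cast_le (α := ℝ)).2 hlow
  simp only [Nat.cast_add, Nat.cast_mul, Nat.cast_ofNat] at hup hlow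
  exact abs_sub_le_of_counting_bounds hr' hn0 (Nat.cast_nonneg _) (Nat.cast_nonneg _)
    (Nat.cast_nonneg _) (Nat.cast_nonneg _) (Nat.cast_nonneg _) (Nat.cast_nonneg _)
    (Nat.cast_nonneg _) hL hlb hc1 hc2 hmm hmm' hd hM hP1 hP2 hA3 hA4 hup hlow

end Estimates

/-- **Lemma 3.6**: for `H ∈ H_r^+(n, m-ξ)` with `ξ = O(1)`, the number `N'_{2r-2}` of
`(2r-2)`-sets of vertices containing exactly one pair of vertices lying in a common edge of
`H` satisfies `N'_{2r-2} = C(r,2) m C(n-2,2r-4) (1 + O((r² n log(r⁻²n) + r⁴ m)/n²))`. -/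
theorem statement7 (r m ξ : ℕ → ℕ) (hr : ∀ n, 3 ≤ r n)
    (hlb : ∀ᶠ n : ℕ in atTop, (n : ℝ) / (r n : ℝ) ^ 2 ≤ (m n : ℝ))
    (hub : (fun n => (m n : ℝ)) =o[atTop]
      (fun n => (n : ℝ) ^ ((3 : ℝ) / 2) / (r n : ℝ) ^ 3))
    (hξ : ∃ B : ℕ, ∀ n, ξ n ≤ B) :
    ∃ C > (0 : ℝ), ∃ n₀ : ℕ, ∀ n ≥ n₀,
      ∀ H ∈ Hplus n (r n) (m n - ξ n),
        |((Finset.univ.powerset.filter fun S : Finset (Fin n) =>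
              S.card = 2 * r n - 2 ∧
              ((S.powersetCard 2).filter fun q => ∃ e ∈ H, q ⊆ e).card = 1).card : ℝ)
            - ((r n).choose 2 : ℝ) * (m n : ℝ) * ((n - 2).choose (2 * r n - 4) : ℝ)|
          ≤ C * (((r n : ℝ) ^ 2 * (n : ℝ) * Real.log ((n : ℝ) / (r n : ℝ) ^ 2)
                + (r n : ℝ) ^ 4 * (m n : ℝ)) / (n : ℝ) ^ 2)
            * (((r n).choose 2 : ℝ) * (m n : ℝ) * ((n - 2).choose (2 * r n - 4) : ℝ)) := by
  obtain ⟨B, hB⟩ := hξ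
  have hbound := hub.def (show (0 : ℝ) < 1 / 4 by norm_num)
  obtain ⟨n₀, hn₀⟩ := eventually_atTop.1 ((hlb.and hbound).and (eventually_ge_atTop 1))
  refine ⟨6000 + B, by positivity, n₀, fun n hn H hH => ?_⟩
  obtain ⟨⟨hlow, hupp⟩, hn1⟩ := hn₀ n hn
  rw [filter_exactly_one_eq]
  have hr3 : (3 : ℝ) ≤ r n := by exact_mod_cast hr n
  have hr0 : (0 : ℝ) < r n := by linarith
  have hn0 : (0 : ℝ) < n := by exact_mod_cast hn1
  have hpow : (n : ℝ) ^ ((3 : ℝ) / 2) = n * √n := by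
    rw [show (3 : ℝ) / 2 = 1 + 1 / 2 by norm_num, Real.rpow_add hn0, Real.rpow_one,
      Real.sqrt_eq_rpow]
  have hs0 : 0 < √(n : ℝ) := Real.sqrt_pos.2 hn0
  have hss : √(n : ℝ) * √n = n := Real.mul_self_sqrt hn0.le
  have hupp : (m n : ℝ) * r n ^ 3 ≤ 1 / 4 * (n * √n) := by
    rw [Real.norm_of_nonneg (by positivity), Real.norm_of_nonneg (by positivity), hpow,
      mul_div_assoc', le_div_iff₀ (by positivity)] at hupp
    exact hupp
  have hlow' : (n : ℝ) ≤ m n * r n ^ 2 := by rwa [div_le_iff₀ (by positivity)] at hlow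
  have hrs : (r n : ℝ) ≤ 1 / 4 * √n := by
    have h : (n : ℝ) * r n ≤ n * (1 / 4 * √n) := by
      nlinarith [mul_le_mul_of_nonneg_right hlow' hr0.le]
    exact le_of_mul_le_mul_left h hn0
  have hrn : 16 * (r n : ℝ) ^ 2 ≤ n := by nlinarith
  refine abs_card_exactly_one_sub_le (hr n) hlow (by nlinarith) ?_ ?_ (hB n) hH
  · rw [Real.le_log_iff_exp_le (by positivity), le_div_iff₀ (by positivity)]
    nlinarith [Real.exp_one_lt_d9, sq_nonneg (r n : ℝ)]
  · rw [div_le_one (by positivity)]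
    have h1 : (r n : ℝ) ^ 4 * m n ≤ r n * (1 / 4 * (n * √n)) := by
      nlinarith [mul_le_mul_of_nonneg_left hupp hr0.le]
    have h2 : (r n : ℝ) * (1 / 4 * (n * √n)) ≤ (1 / 4 * √n) * (1 / 4 * (n * √n)) := by gcongr
    nlinarith
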